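/- Let H be a real Hilbert space with an orthogonal splitting H = H^u ⊕ H^s into closed subspaces, with orthogonal projections P^u and P^s. Let F be a C¹ vector field defined on an open neighborhood U of 0 in H with F(0) = 0, and assume there is λ > 0 such that L = DF(0) satisfies L(H^u) ⊆ H^u, L(H^s) ⊆ H^s, ⟨Lξ,ξ⟩ ≥ λ‖ξ‖² for all ξ ∈ H^u, and ⟨Lξ,ξ⟩ ≤ −λ‖ξ‖² for all ξ ∈ H^s. For r > 0 set Q(r) = {ξ : ‖P^uξ‖ ≤ r, ‖P^sξ‖ ≤ r}, ∂Q(r) = {ξ ∈ Q(r) : ‖P^uξ‖ = r or ‖P^sξ‖ = r}, and define the local unstable manifold W^u_{loc,r} = {ξ ∈ Q(r) : there is a C¹ curve v : (−∞,0] → U with v′ = F(v), v((−∞,0]) ⊆ Q(r), v(0) = ξ}. Then there exists r₀ > 0 such that for every r ∈ (0,r₀] the following holds. For any sequence (ξ_n) ⊆ H converging to 0, any t_n ≥ 0, and any C¹ solutions u_n : [0,t_n] → U of u′ = F(u) with u_n(0) = ξ_n, u_n([0,t_n]) ⊆ Q(r), and u_n(t_n) ∈ ∂Q(r): dist(u_n(t_n),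 W^u_{loc,r} ∩ ∂Q(r)) → 0. If moreover f is a non-degenerate local Lyapunov function for F at 0, then limsup_{n→∞} f(u_n(t_n)) < f(0), and there exists r′ ∈ (0,r) such that sup{ f(ξ) : ξ ∈ ∂Q(r) and there exist T > 0 and a C¹ curve v : [0,T] → U with v′ = F(v), v(0) ∈ Q(r′), v([0,T]) ⊆ Q(r), v(T) = ξ } < inf{ f(ξ) : ξ ∈ Q(r′) }. -/

import Mathlib

open Module Submodule Set Filter
open scoped RealInnerProductSpace

section Defs

variable {H : Type*} [NormedAddCommGroup H] [InnerProductSpace ℝ H] [CompleteSpace H]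

/-- The orthogonal projection onto a closed subspace of a real Hilbert space,
as a continuous linear operator `H →L[ℝ] H`. -/
noncomputable def orthProjL (V : Submodule ℝ H) (hV : IsClosed (V : Set H)) : H →L[ℝ] H :=
  haveI : CompleteSpace V := hV.completeSpace_coe
  V.subtypeL.comp (orthogonalProjection V)

/-- The set `Q(r) = {ξ : ‖P^u ξ‖ ≤ r and ‖P^s ξ‖ ≤ r}`. -/
noncomputable def squareNbhd (Hu Hs : Submodule ℝ H)
    (hu : IsClosed (Hu : Set H)) (hs : IsClosed (Hs : Set H)) (r : ℝ) : Set H :=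
  {ξ | ‖orthProjL Hu hu ξ‖ ≤ r ∧ ‖orthProjL Hs hs ξ‖ ≤ r}

/-- The boundary `∂Q(r) = {ξ ∈ Q(r) : ‖P^u ξ‖ = r or ‖P^s ξ‖ = r}`. -/
noncomputable def squareNbhdBdry (Hu Hs : Submodule ℝ H)
    (hu : IsClosed (Hu : Set H)) (hs : IsClosed (Hs : Set H)) (r : ℝ) : Set H :=
  {ξ ∈ squareNbhd Hu Hs hu hs r |
    ‖orthProjL Hu hu ξ‖ = r ∨ ‖orthProjL Hs hs ξ‖ = r}

/-- The local unstable manifold `W^u_{loc,r}` of the rest point `0` of the vector field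
`F` defined on `U`: the points of `Q(r)` which are endpoints of backward solutions of
`u' = F(u)` remaining in `Q(r)`. -/
noncomputable def localUnstableSet (Hu Hs : Submodule ℝ H)
    (hu : IsClosed (Hu : Set H)) (hs : IsClosed (Hs : Set H))
    (U : Set H) (F : H → H) (r : ℝ) : Set H :=
  {ξ ∈ squareNbhd Hu Hs hu hs r | ∃ v : ℝ → H, v 0 = ξ ∧
    (∀ s : ℝ, s ≤ 0 → v s ∈ U ∧ v s ∈ squareNbhd Hu Hs hu hs r) ∧
    (∀ s : ℝ, s ≤ 0 → HasDerivWithinAt v (F (v s)) (Iic 0) s)}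

end Defs

section Helpers

variable {H : Type*} [NormedAddCommGroup H] [InnerProductSpace ℝ H] [CompleteSpace H]

/-- Abstract form of the hyperbolic splitting. -/
structure HypSplit (L P S : H →L[ℝ] H) (lam : ℝ) : Prop where
  pos : 0 < lam
  sum : ∀ x, P x + S x = x
  ort : ∀ x y, ⟪P x, S y⟫ = 0
  commP : ∀ x, P (L x) = L (P x)
  commS : ∀ x, S (L x) = L (S x)
  coP : ∀ x, lam * ‖P x‖ ^ 2 ≤ ⟪L (P x), P x⟫
  coS : ∀ x, ⟪L (S x), S x⟫ ≤ -lam * ‖S x‖ ^ 2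

theorem gronwall_aux (y y' : ℝ → ℝ) (k a b : ℝ) (hab : a ≤ b)
    (hy : ∀ s ∈ Icc a b, HasDerivWithinAt y (y' s) (Icc a b) s)
    (hle : ∀ s ∈ Icc a b, y' s ≤ -k * y s) :
    y b ≤ Real.exp (-k * (b - a)) * y a := by
  have hd : ∀ s ∈ Icc a b, HasDerivWithinAt (fun s => Real.exp (k * s) * y s)
      (Real.exp (k * s) * (k * 1) * y s + Real.exp (k * s) * y' s) (Icc a b) s := fun s hs =>
    (((hasDerivAt_id s).const_mul k).exp.hasDerivWithinAt).mul (hy s hs)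
  have hanti : AntitoneOn (fun s => Real.exp (k * s) * y s) (Icc a b) := by
    apply antitoneOn_of_deriv_nonpos (convex_Icc a b)
    · exact fun s hs => (hd s hs).continuousWithinAt
    · intro s hs
      exact ((hd s (interior_subset hs)).mono interior_subset).differentiableWithinAt
    · intro s hs
      have h1 := (hd s (interior_subset hs)).hasDerivAt (mem_interior_iff_mem_nhds.1 hs)
      rw [h1.deriv]
      have := hle s (interior_subset hs)
      have he := Real.exp_pos (k * s)
      nlinarith
  have h := hanti (left_mem_Icc.2 hab) (right_mem_Icc.2 hab) hab
  simp only at h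
  have e : Real.exp (-k * (b - a)) = Real.exp (k * a) / Real.exp (k * b) := by
    rw [← Real.exp_sub]; ring_nf
  rw [e, div_mul_eq_mul_div, le_div_iff₀ (Real.exp_pos _)]
  linarith

namespace HypSplit

variable {L P S : H →L[ℝ] H} {lam : ℝ}

theorem ort' (h : HypSplit L P S lam) (x y : H) : ⟪S x, P y⟫ = 0 := by
  rw [real_inner_comm]; exact h.ort y x

theorem PS (h : HypSplit L P S lam) (x : H) : P (S x) = 0 := by
  have h1 : P (S x) = S (x - S x) := by
    have := h.sum (S x)
    rw [map_sub]; exact eq_sub_of_add_eq this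
  have h2 := h.ort (S x) (x - S x)
  rw [← h1] at h2
  exact inner_self_eq_zero.1 h2

theorem SP (h : HypSplit L P S lam) (x : H) : S (P x) = 0 := by
  have h1 : S (P x) = P (x - P x) := by
    have := h.sum (P x)
    rw [map_sub]; exact eq_sub_of_add_eq' this
  have h2 := h.ort (x - P x) (P x)
  rw [← h1] at h2
  exact inner_self_eq_zero.1 h2

theorem PP (h : HypSplit L P S lam) (x : H) : P (P x) = P x := by
  have := h.sum (P x)
  rwa [h.SP, add_zero] at this

theorem SS (h : HypSplit L P S lam) (x : H) : S (S x) = S x := by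
  have := h.sum (S x)
  rwa [h.PS, zero_add] at this

theorem inP (h : HypSplit L P S lam) (x y : H) : ⟪P x, P y⟫ = ⟪P x, y⟫ := by
  conv_rhs => rw [← h.sum y, inner_add_right, h.ort, add_zero]

theorem inS (h : HypSplit L P S lam) (x y : H) : ⟪S x, S y⟫ = ⟪S x, y⟫ := by
  conv_rhs => rw [← h.sum y, inner_add_right, h.ort', zero_add]

theorem norm_sq (h : HypSplit L P S lam) (x : H) : ‖x‖ ^ 2 = ‖P x‖ ^ 2 + ‖S x‖ ^ 2 := by
  conv_lhs => rw [← h.sum x]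
  rw [norm_add_sq_real, h.ort]; ring

theorem norm_le_add (h : HypSplit L P S lam) (x : H) : ‖x‖ ≤ ‖P x‖ + ‖S x‖ := by
  conv_lhs => rw [← h.sum x]
  exact norm_add_le _ _

theorem normP_le (h : HypSplit L P S lam) (x : H) : ‖P x‖ ≤ ‖x‖ := by
  have := h.norm_sq x
  exact abs_le_of_sq_le_sq' (by nlinarith [sq_nonneg ‖S x‖]) (norm_nonneg _) |>.2

theorem normS_le (h : HypSplit L P S lam) (x : H) : ‖S x‖ ≤ ‖x‖ := by
  have := h.norm_sq x
  exact abs_le_of_sq_le_sq' (by nlinarith [sq_nonneg ‖P x‖]) (norm_nonneg _) |>.2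

/-- pairing estimates -/
theorem pairP (h : HypSplit L P S lam) (x d : H) : lam * ‖P x‖ ^ 2 - ‖d‖ * ‖P x‖ ≤ ⟪P x, P (L x + d)⟫ := by
  rw [h.inP, inner_add_right, ← h.inP, h.commP, real_inner_comm]
  have h1 := h.coP x
  have h2 := abs_le.1 (abs_real_inner_le_norm (P x) d)
  nlinarith

theorem pairS (h : HypSplit L P S lam) (x d : H) : ⟪S x, S (L x + d)⟫ ≤ -lam * ‖S x‖ ^ 2 + ‖d‖ * ‖S x‖ := by
  rw [h.inS, inner_add_right, ← h.inS, h.commS, real_inner_comm]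
  have h1 := h.coS x
  have h2 := abs_le.1 (abs_real_inner_le_norm (S x) d)
  nlinarith

theorem expS (h : HypSplit L P S lam) {t : ℝ} (ht : 0 ≤ t) (x : H) :
    ‖NormedSpace.exp (t • L) (S x)‖ ≤ Real.exp (-lam * t) * ‖S x‖ := by
  have hc : ∀ s : ℝ, S (NormedSpace.exp (s • L) (S x)) = NormedSpace.exp (s • L) (S x) := by
    intro s
    have hcomm : Commute S (s • L) := by
      apply Commute.smul_right
      ext z; exact h.commS z
    have := DFunLike.congr_fun hcomm.exp_right.eq (S x)
    simp only [ContinuousLinearMap.mul_apply, h.SS] at this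
    exact this
  have hd : ∀ s : ℝ, HasDerivAt (fun s : ℝ => NormedSpace.exp (s • L) (S x))
      (L (NormedSpace.exp (s • L) (S x))) s := by
    intro s
    have := (hasDerivAt_exp_smul_const' L s).clm_apply (hasDerivAt_const s (S x))
    simpa using this
  have := gronwall_aux (fun s => ‖NormedSpace.exp (s • L) (S x)‖ ^ 2) _ (2 * lam) 0 t ht
    (fun s _ => (hd s).norm_sq.hasDerivWithinAt) (by
      intro s _
      have := h.coS (NormedSpace.exp (s • L) (S x))
      rw [hc, real_inner_comm] at this
      linarith)
  simp only [sub_zero, zero_smul, NormedSpace.exp_zero, ContinuousLinearMap.one_apply] at this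
  have e : Real.exp (-(2 * lam) * t) = Real.exp (-lam * t) ^ 2 := by
    rw [← Real.exp_nat_mul]; push_cast; ring_nf
  rw [e, ← mul_pow] at this
  exact abs_le_of_sq_le_sq' this (by positivity) |>.2

theorem commute_expP (h : HypSplit L P S lam) (s : ℝ) (x : H) :
    P (NormedSpace.exp (s • L) x) = NormedSpace.exp (s • L) (P x) := by
  have hcomm : Commute P (s • L) := by
    apply Commute.smul_right
    ext z; exact h.commP z
  exact DFunLike.congr_fun hcomm.exp_right.eq x

theorem commute_expS (h : HypSplit L P S lam) (s : ℝ) (x : H) :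
    S (NormedSpace.exp (s • L) x) = NormedSpace.exp (s • L) (S x) := by
  have hcomm : Commute S (s • L) := by
    apply Commute.smul_right
    ext z; exact h.commS z
  exact DFunLike.congr_fun hcomm.exp_right.eq x

end HypSplit

theorem exp_add_smul (L : H →L[ℝ] H) (s t : ℝ) (x : H) :
    NormedSpace.exp ((s + t) • L) x = NormedSpace.exp (s • L) (NormedSpace.exp (t • L) x) := by
  letI : NormedAlgebra ℚ (H →L[ℝ] H) := NormedAlgebra.restrictScalars ℚ ℝ _
  rw [add_smul, NormedSpace.exp_add_of_commute]
  · rfl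
  · exact ((Commute.refl L).smul_left s).smul_right t

theorem continuous_expL (L : H →L[ℝ] H) : Continuous (fun t : ℝ => NormedSpace.exp (t • L)) :=
  continuous_iff_continuousAt.2 fun t => (hasDerivAt_exp_smul_const L t).continuousAt

/-- The Lyapunov-Perron operator. -/
noncomputable def lpOp (L S : H →L[ℝ] H) (η : H) (g : ℝ → H) (t : ℝ) : H :=
  NormedSpace.exp (t • L) (η + (∫ τ in Iic (0 : ℝ), NormedSpace.exp ((-τ) • L) (S (g τ))) +
    ∫ τ in (0 : ℝ)..t, NormedSpace.exp ((-τ) • L) (g τ))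

theorem lpOp_cont_integrand (L : H →L[ℝ] H) {g : ℝ → H} (hg : Continuous g) :
    Continuous (fun τ : ℝ => NormedSpace.exp ((-τ) • L) (g τ)) :=
  ((continuous_expL L).comp continuous_neg).clm_apply hg

theorem exp_cancel (L : H →L[ℝ] H) (t : ℝ) (x : H) :
    NormedSpace.exp (t • L) (NormedSpace.exp ((-t) • L) x) = x := by
  rw [← exp_add_smul]; simp

theorem lpOp_hasDerivAt (L S : H →L[ℝ] H) (η : H) {g : ℝ → H} (hg : Continuous g) (t : ℝ) :
    HasDerivAt (lpOp L S η g) (L (lpOp L S η g t) + g t) t := by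
  have hc := lpOp_cont_integrand L hg
  have h1 := (hasDerivAt_exp_smul_const' L t).clm_apply
    ((intervalIntegral.integral_hasDerivAt_right (hc.intervalIntegrable 0 t)
      hc.stronglyMeasurable.stronglyMeasurableAtFilter hc.continuousAt).const_add
      (η + (∫ τ in Iic (0 : ℝ), NormedSpace.exp ((-τ) • L) (S (g τ)))))
  rw [exp_cancel] at h1
  exact h1

namespace HypSplit

variable {L P S : H →L[ℝ] H} {lam : ℝ}

theorem integrand_le (h : HypSplit L P S lam) {g : ℝ → H} {M : ℝ} (hM : ∀ τ, ‖g τ‖ ≤ M) {t τ : ℝ} (hτ : τ ≤ t) :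
    ‖NormedSpace.exp ((t - τ) • L) (S (g τ))‖ ≤
      Real.exp (lam * τ) * (Real.exp (-lam * t) * M) := by
  refine (h.expS (sub_nonneg.2 hτ) (g τ)).trans ?_
  have e : Real.exp (lam * τ) * (Real.exp (-lam * t) * M) = Real.exp (-lam * (t - τ)) * M := by
    rw [← mul_assoc, ← Real.exp_add]; ring_nf
  rw [e]
  exact mul_le_mul_of_nonneg_left ((h.normS_le _).trans (hM τ)) (Real.exp_pos _).le

theorem integrand_integrable (h : HypSplit L P S lam) {g : ℝ → H} (hg : Continuous g) {M : ℝ} (hM : ∀ τ, ‖g τ‖ ≤ M)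
    (t : ℝ) : MeasureTheory.IntegrableOn
      (fun τ => NormedSpace.exp ((t - τ) • L) (S (g τ))) (Iic t) := by
  have hi := (integrableOn_exp_mul_Iic h.pos t).mul_const (Real.exp (-lam * t) * M)
  refine MeasureTheory.Integrable.mono' hi ?_ ?_
  · exact (((continuous_expL L).comp (continuous_const.sub continuous_id)).clm_apply
      (S.continuous.comp hg)).aestronglyMeasurable
  · exact (MeasureTheory.ae_restrict_mem measurableSet_Iic).mono
      fun τ hτ => h.integrand_le hM hτ

theorem integrand_integrable' (h : HypSplit L P S lam) {g : ℝ → H} (hg : Continuous g) {M : ℝ} (hM : ∀ τ, ‖g τ‖ ≤ M)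
    (t : ℝ) : MeasureTheory.IntegrableOn
      (fun τ => NormedSpace.exp ((-τ) • L) (S (g τ))) (Iic t) := by
  have := (NormedSpace.exp ((-t) • L)).integrable_comp (h.integrand_integrable hg hM t)
  refine this.congr (Filter.Eventually.of_forall fun τ => ?_)
  simp only
  rw [← exp_add_smul]; congr 3; ring

theorem S_lpOp (h : HypSplit L P S lam) {η : H} (hη : P η = η) {g : ℝ → H} (hg : Continuous g) {M : ℝ}
    (hM : ∀ τ, ‖g τ‖ ≤ M) (t : ℝ) :
    S (lpOp L S η g t) = ∫ τ in Iic t, NormedSpace.exp ((t - τ) • L) (S (g τ)) := by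
  have hi := h.integrand_integrable' hg hM
  have hSη : S η = 0 := by rw [← hη, h.SP]
  have e1 : S (∫ τ in Iic (0 : ℝ), NormedSpace.exp ((-τ) • L) (S (g τ))) =
      ∫ τ in Iic (0 : ℝ), NormedSpace.exp ((-τ) • L) (S (g τ)) := by
    rw [← ContinuousLinearMap.integral_comp_comm S (hi 0)]
    simp only [h.commute_expS, h.SS]
  have e2 : S (∫ τ in (0 : ℝ)..t, NormedSpace.exp ((-τ) • L) (g τ)) =
      ∫ τ in (0 : ℝ)..t, NormedSpace.exp ((-τ) • L) (S (g τ)) := by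
    rw [← ContinuousLinearMap.intervalIntegral_comp_comm S
      ((lpOp_cont_integrand L hg).intervalIntegrable 0 t)]
    simp only [h.commute_expS]
  unfold lpOp
  rw [h.commute_expS, map_add S, map_add S, hSη, zero_add, e1, e2,
    ← intervalIntegral.integral_Iic_sub_Iic (hi 0) (hi t), add_sub_cancel,
    ← ContinuousLinearMap.integral_comp_comm _ (hi t)]
  congr 1
  ext τ
  rw [← exp_add_smul]; congr 3

theorem S_lpOp_le (h : HypSplit L P S lam) {η : H} (hη : P η = η) {g : ℝ → H} (hg : Continuous g) {M : ℝ}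
    (hM : ∀ τ, ‖g τ‖ ≤ M) (t : ℝ) : ‖S (lpOp L S η g t)‖ ≤ M / lam := by
  rw [h.S_lpOp hη hg hM]
  have hi := (integrableOn_exp_mul_Iic h.pos t).mul_const (Real.exp (-lam * t) * M)
  refine (MeasureTheory.norm_integral_le_of_norm_le hi
    ((MeasureTheory.ae_restrict_mem measurableSet_Iic).mono
      fun τ hτ => h.integrand_le hM hτ)).trans (le_of_eq ?_)
  rw [MeasureTheory.integral_mul_const, integral_exp_mul_Iic h.pos, div_mul_eq_mul_div,
    ← mul_assoc, ← Real.exp_add]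
  simp

theorem P_lpOp_zero (h : HypSplit L P S lam) {η : H} (hη : P η = η) {g : ℝ → H} (hg : Continuous g) {M : ℝ}
    (hM : ∀ τ, ‖g τ‖ ≤ M) : P (lpOp L S η g 0) = η := by
  have hi := h.integrand_integrable' hg hM
  have e1 : P (∫ τ in Iic (0 : ℝ), NormedSpace.exp ((-τ) • L) (S (g τ))) = 0 := by
    rw [← ContinuousLinearMap.integral_comp_comm P (hi 0)]
    simp only [h.commute_expP, h.PS, map_zero, MeasureTheory.integral_zero]
  unfold lpOp
  rw [h.commute_expP]
  rw [map_add P, map_add P, e1, hη]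
  simp

theorem P_lpOp_le (h : HypSplit L P S lam) {η : H} (hη : P η = η) {g : ℝ → H} (hg : Continuous g) {M : ℝ}
    (hM : ∀ τ, ‖g τ‖ ≤ M) {r : ℝ} (h1 : ‖η‖ ≤ r) (h2 : M / lam ≤ r) {t : ℝ} (ht : t ≤ 0) :
    ‖P (lpOp L S η g t)‖ ≤ r := by
  have hl := h.pos
  have hM0 : 0 ≤ M := (norm_nonneg _).trans (hM 0)
  have hr : 0 ≤ r := (norm_nonneg _).trans h1
  have h2' : M ≤ r * lam := (div_le_iff₀ hl).1 h2
  have hd : ∀ s : ℝ, HasDerivAt (fun s => P (lpOp L S η g (-s)))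
      (P ((-1 : ℝ) • (L (lpOp L S η g (-s)) + g (-s)))) s := fun s =>
    P.hasFDerivAt.comp_hasDerivAt s
      (HasDerivAt.scomp s (lpOp_hasDerivAt L S η hg (-s)) (hasDerivAt_neg s))
  have := gronwall_aux (fun s => ‖P (lpOp L S η g (-s))‖ ^ 2 - r ^ 2) _ lam 0 (-t) (by linarith)
    (fun s _ => ((hd s).norm_sq.sub_const _).hasDerivWithinAt) (by
      intro s _
      have h3 := h.pairP (lpOp L S η g (-s)) (g (-s))
      have h4 := hM (-s)
      have h5 := norm_nonneg (P (lpOp L S η g (-s)))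
      rw [map_smul, inner_smul_right]
      set p := ‖P (lpOp L S η g (-s))‖
      have h6 : ‖g (-s)‖ * p ≤ r * lam * p := mul_le_mul_of_nonneg_right (h4.trans h2') h5
      nlinarith [mul_nonneg hl.le (sq_nonneg (p - r))])
  simp only [neg_neg, neg_zero, h.P_lpOp_zero hη hg hM] at this
  have h7 : ‖η‖ ^ 2 - r ^ 2 ≤ 0 := by nlinarith [norm_nonneg η]
  have h8 := mul_nonpos_of_nonneg_of_nonpos (Real.exp_pos (-lam * (-t - 0))).le h7
  exact abs_le_of_sq_le_sq' (by linarith) hr |>.2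

theorem lpOp_sub (h : HypSplit L P S lam) {η : H} {g g2 : ℝ → H} (hg : Continuous g) (hg2 : Continuous g2) {M : ℝ}
    (hM : ∀ τ, ‖g τ‖ ≤ M) (hM2 : ∀ τ, ‖g2 τ‖ ≤ M) (t : ℝ) :
    lpOp L S η g t - lpOp L S η g2 t = lpOp L S 0 (fun τ => g τ - g2 τ) t := by
  unfold lpOp
  simp only [map_sub]
  rw [MeasureTheory.integral_sub (h.integrand_integrable' hg hM 0)
    (h.integrand_integrable' hg2 hM2 0), intervalIntegral.integral_sub
    ((lpOp_cont_integrand L hg).intervalIntegrable 0 t)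
    ((lpOp_cont_integrand L hg2).intervalIntegrable 0 t), ← map_sub]
  congr 1
  abel

end HypSplit

theorem HypSplit.exists_backward {L P S : H →L[ℝ] H} {lam : ℝ} (h : HypSplit L P S lam)
    (N : H → H) (r ε : ℝ) (hε : 0 ≤ ε) (hε2 : 4 * ε ≤ lam) (hN0 : N 0 = 0)
    (hN : ∀ x y, ‖P x‖ ≤ r → ‖S x‖ ≤ r → ‖P y‖ ≤ r → ‖S y‖ ≤ r → ‖N x - N y‖ ≤ ε * ‖x - y‖)
    (η : H) (hη : P η = η) (hηr : ‖η‖ ≤ r) :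
    ∃ v : ℝ → H, P (v 0) = η ∧ ∀ s ≤ 0, ‖P (v s)‖ ≤ r ∧ ‖S (v s)‖ ≤ r ∧
      HasDerivWithinAt v (L (v s) + N (v s)) (Iic 0) s := by
  have hl := h.pos
  have hr : 0 ≤ r := (norm_nonneg _).trans hηr
  let X : Set (BoundedContinuousFunction ℝ H) := {v | ∀ t, ‖P (v t)‖ ≤ r ∧ ‖S (v t)‖ ≤ r}
  have hXc : IsClosed X := by
    have : X = ⋂ t : ℝ, {v : BoundedContinuousFunction ℝ H | ‖P (v t)‖ ≤ r ∧ ‖S (v t)‖ ≤ r} := by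
      ext v; simp [X]
    rw [this]
    refine isClosed_iInter fun t => ?_
    have hev : Continuous fun v : BoundedContinuousFunction ℝ H => v t :=
      continuous_eval_const t
    exact (isClosed_le (P.continuous.comp hev).norm continuous_const).inter
      (isClosed_le (S.continuous.comp hev).norm continuous_const)
  have hXcomp : CompleteSpace X := hXc.completeSpace_coe
  have hXne : Nonempty X := ⟨⟨0, fun t => by simpa using hr⟩⟩
  have hNcont : ContinuousOn N {x | ‖P x‖ ≤ r ∧ ‖S x‖ ≤ r} := by
    have : LipschitzOnWith ⟨ε, hε⟩ N {x | ‖P x‖ ≤ r ∧ ‖S x‖ ≤ r} := by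
      apply LipschitzOnWith.of_dist_le_mul
      intro x hx y hy
      rw [dist_eq_norm, dist_eq_norm]
      exact hN x y hx.1 hx.2 hy.1 hy.2
    exact this.continuousOn
  have hgc : ∀ v : X, Continuous fun t => N (v.1 t) := fun v =>
    hNcont.comp_continuous v.1.continuous v.2
  have hgM : ∀ v : X, ∀ t, ‖N (v.1 t)‖ ≤ 2 * ε * r := by
    intro v t
    have h1 := hN (v.1 t) 0 (v.2 t).1 (v.2 t).2 (by simpa using hr) (by simpa using hr)
    rw [hN0, sub_zero, sub_zero] at h1
    have h2 := h.norm_le_add (v.1 t)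
    have h3 := (v.2 t).1
    have h4 := (v.2 t).2
    nlinarith
  have hMr : 2 * ε * r / lam ≤ r := by
    rw [div_le_iff₀ hl]; nlinarith
  have hb : ∀ v : X, ∀ t ≤ 0, ‖P (lpOp L S η (fun t => N (v.1 t)) t)‖ ≤ r ∧
      ‖S (lpOp L S η (fun t => N (v.1 t)) t)‖ ≤ r := fun v t ht =>
    ⟨h.P_lpOp_le hη (hgc v) (hgM v) hηr hMr ht,
      (h.S_lpOp_le hη (hgc v) (hgM v) t).trans hMr⟩
  let Φ : X → X := fun v =>
    ⟨BoundedContinuousFunction.ofNormedAddCommGroup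
      (fun t => lpOp L S η (fun t => N (v.1 t)) (min t 0))
      ((continuous_iff_continuousAt.2 fun t =>
        (lpOp_hasDerivAt L S η (hgc v) t).continuousAt).comp (continuous_id.min continuous_const))
      (2 * r) (fun t => by
        have := hb v (min t 0) (min_le_right _ _)
        linarith [h.norm_le_add (lpOp L S η (fun t => N (v.1 t)) (min t 0)), this.1, this.2]),
      fun t => hb v (min t 0) (min_le_right _ _)⟩
  have hΦ : ∀ (v : X) (t : ℝ), (Φ v).1 t = lpOp L S η (fun t => N (v.1 t)) (min t 0) :=
    fun _ _ => rfl
  have hcontr : ContractingWith (1 / 2) Φ := by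
    refine ⟨by rw [← NNReal.coe_lt_coe]; norm_num, LipschitzWith.of_dist_le_mul fun v w => ?_⟩
    rw [Subtype.dist_eq, Subtype.dist_eq, BoundedContinuousFunction.dist_le (by positivity)]
    intro t
    rw [hΦ, hΦ, dist_eq_norm, h.lpOp_sub (hgc v) (hgc w) (hgM v) (hgM w)]
    set D := dist v.1 w.1
    have hD0 : 0 ≤ D := dist_nonneg
    have hgM' : ∀ τ, ‖N (v.1 τ) - N (w.1 τ)‖ ≤ ε * D := by
      intro τ
      refine (hN _ _ (v.2 τ).1 (v.2 τ).2 (w.2 τ).1 (w.2 τ).2).trans ?_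
      rw [← dist_eq_norm]
      exact mul_le_mul_of_nonneg_left (BoundedContinuousFunction.dist_coe_le_dist τ) hε
    have hc' : Continuous fun τ => N (v.1 τ) - N (w.1 τ) := (hgc v).sub (hgc w)
    have i1 := h.S_lpOp_le (map_zero P) hc' hgM' (min t 0)
    have i2 := h.P_lpOp_le (map_zero P) hc' hgM' (r := ε * D / lam)
      (by rw [norm_zero]; positivity) le_rfl (min_le_right t 0)
    have i3 := h.norm_le_add (lpOp L S 0 (fun τ => N (v.1 τ) - N (w.1 τ)) (min t 0))
    have i4 : ε * D / lam ≤ D / 4 := by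
      rw [div_le_iff₀ hl]; nlinarith
    have : ((1 / 2 : NNReal) : ℝ) = 1 / 2 := by norm_num
    rw [this]
    linarith
  obtain ⟨v, hv⟩ : ∃ v, Φ v = v := ⟨_, hcontr.fixedPoint_isFixedPt⟩
  have hv' : ∀ t ≤ 0, v.1 t = lpOp L S η (fun t => N (v.1 t)) t := by
    intro t ht
    have := hΦ v t
    rwa [hv, min_eq_left ht] at this
  refine ⟨v.1, ?_, fun s hs => ⟨(v.2 s).1, (v.2 s).2, ?_⟩⟩
  · rw [hv' 0 le_rfl]
    exact h.P_lpOp_zero hη (hgc v) (hgM v)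
  · have hd := (lpOp_hasDerivAt L S η (hgc v) s).hasDerivWithinAt (s := Iic 0)
    rw [← hv' s hs] at hd
    exact hd.congr (fun t ht => hv' t ht) (hv' s hs)

/-- Exponential decay of the indefinite form along differences of two solutions. -/
theorem HypSplit.cone {L P S : H →L[ℝ] H} {lam : ℝ} (h : HypSplit L P S lam)
    (w d : ℝ → H) (T ε : ℝ) (hT : 0 ≤ T) (hε2 : 4 * ε ≤ lam)
    (hw : ∀ s ∈ Icc 0 T, HasDerivWithinAt w (L (w s) + d s) (Icc 0 T) s)
    (hd : ∀ s ∈ Icc 0 T, ‖d s‖ ≤ ε * ‖w s‖) :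
    ‖S (w T)‖ ^ 2 - ‖P (w T)‖ ^ 2 ≤ Real.exp (-lam * T) * (‖S (w 0)‖ ^ 2 - ‖P (w 0)‖ ^ 2) := by
  have hl := h.pos
  have := gronwall_aux (fun s => ‖S (w s)‖ ^ 2 - ‖P (w s)‖ ^ 2) _ lam 0 T hT
    (fun s hs => (S.hasFDerivAt.comp_hasDerivWithinAt s (hw s hs)).norm_sq.sub
      (P.hasFDerivAt.comp_hasDerivWithinAt s (hw s hs)).norm_sq) (by
      intro s hs
      have h1 := h.pairP (w s) (d s)
      have h2 := h.pairS (w s) (d s)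
      have h3 := hd s hs
      have h4 := h.norm_sq (w s)
      have h5 := h.normP_le (w s)
      have h6 := h.normS_le (w s)
      have n1 := norm_nonneg (P (w s))
      have n2 := norm_nonneg (S (w s))
      have n0 := norm_nonneg (w s)
      have nd := norm_nonneg (d s)
      have k0 : ‖d s‖ ≤ lam / 4 * ‖w s‖ := h3.trans (by nlinarith)
      have k1 : ‖d s‖ * ‖P (w s)‖ ≤ lam / 4 * ‖w s‖ ^ 2 := by
        calc ‖d s‖ * ‖P (w s)‖ ≤ (lam / 4 * ‖w s‖) * ‖w s‖ := by gcongr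
          _ = _ := by ring
      have k2 : ‖d s‖ * ‖S (w s)‖ ≤ lam / 4 * ‖w s‖ ^ 2 := by
        calc ‖d s‖ * ‖S (w s)‖ ≤ (lam / 4 * ‖w s‖) * ‖w s‖ := by gcongr
          _ = _ := by ring
      simp only [Function.comp_apply]
      nlinarith [mul_nonneg hl.le (sq_nonneg ‖P (w s)‖)])
  simpa using this

/-- Control of the stable component along a solution. -/
theorem HypSplit.stable_bound {L P S : H →L[ℝ] H} {lam : ℝ} (h : HypSplit L P S lam)
    (u d : ℝ → H) (T r σ : ℝ) (hT : 0 ≤ T) (hr : 0 ≤ r) (hσ : 0 ≤ σ)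
    (hu : ∀ s ∈ Icc 0 T, HasDerivWithinAt u (L (u s) + d s) (Icc 0 T) s)
    (hd : ∀ s ∈ Icc 0 T, ‖d s‖ ≤ lam * σ * r) (h0 : ‖S (u 0)‖ ≤ σ * r) :
    ‖S (u T)‖ ≤ σ * r := by
  have hl := h.pos
  have := gronwall_aux (fun s => ‖S (u s)‖ ^ 2 - (σ * r) ^ 2) _ lam 0 T hT
    (fun s hs => (S.hasFDerivAt.comp_hasDerivWithinAt s (hu s hs)).norm_sq.sub_const _) (by
      intro s hs
      have h2 := h.pairS (u s) (d s)
      have h3 := hd s hs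
      have n2 := norm_nonneg (S (u s))
      simp only [Function.comp_apply]
      have : ‖d s‖ * ‖S (u s)‖ ≤ lam * σ * r * ‖S (u s)‖ := by gcongr
      nlinarith [mul_nonneg hl.le (sq_nonneg (‖S (u s)‖ - σ * r))])
  have h7 : ‖S (u 0)‖ ^ 2 - (σ * r) ^ 2 ≤ 0 := by
    have := pow_le_pow_left₀ (norm_nonneg _) h0 2
    linarith
  have h8 := mul_nonpos_of_nonneg_of_nonpos (Real.exp_pos (-lam * (T - 0))).le h7
  exact abs_le_of_sq_le_sq' (by linarith) (by positivity) |>.2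

/-- Growth bound. -/
theorem growth_bound (u : ℝ → H) (u' : ℝ → H) (T K : ℝ) (hT : 0 ≤ T)
    (hu : ∀ s ∈ Icc 0 T, HasDerivWithinAt u (u' s) (Icc 0 T) s)
    (hd : ∀ s ∈ Icc 0 T, ‖u' s‖ ≤ K * ‖u s‖) :
    ‖u T‖ ^ 2 ≤ Real.exp (2 * K * T) * ‖u 0‖ ^ 2 := by
  have := gronwall_aux (fun s => ‖u s‖ ^ 2) _ (-(2 * K)) 0 T hT
    (fun s hs => (hu s hs).norm_sq) (by
      intro s hs
      have h1 := (abs_le.1 (abs_real_inner_le_norm (u s) (u' s))).2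
      have h2 := mul_le_mul_of_nonneg_left (hd s hs) (norm_nonneg (u s))
      nlinarith)
  simpa using this

/-- The rest point is critical for a Lyapunov function. -/
theorem HypSplit.crit {L P S : H →L[ℝ] H} {lam : ℝ} (h : HypSplit L P S lam)
    (F : H → H) (hF0 : F 0 = 0) (hL : HasFDerivAt F L 0)
    (Uf : Set H) (hUf : IsOpen Uf) (h0Uf : (0 : H) ∈ Uf) (f' : H → (H →L[ℝ] ℝ))
    (hlyap : ∀ ξ ∈ Uf, ξ ≠ 0 → f' ξ (F ξ) < 0)
    (f'' : H →L[ℝ] H →L[ℝ] ℝ) (hf'' : HasFDerivAt f' f'' 0) : f' 0 = 0 := by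
  have hl := h.pos
  have key : ∀ x, f' 0 (L x) = 0 := by
    have hd : HasFDerivAt (fun ξ => f' ξ (F ξ)) ((f' 0).comp L + f''.flip (F 0)) 0 :=
      hf''.clm_apply hL
    have hm : IsLocalMax (fun ξ => f' ξ (F ξ)) 0 := by
      filter_upwards [hUf.mem_nhds h0Uf] with ξ hξ
      by_cases h0 : ξ = 0
      · rw [h0]
      · rw [hF0, map_zero]; exact (hlyap ξ hξ h0).le
    have := hm.hasFDerivAt_eq_zero hd
    intro x
    have := DFunLike.congr_fun this x
    simpa [hF0] using this
  obtain ⟨a, ha⟩ : ∃ a : H, ∀ x, f' 0 x = ⟪a, x⟫ :=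
    ⟨(InnerProductSpace.toDual ℝ H).symm (f' 0), fun x => by simp⟩
  have hP : P a = 0 := by
    have h1 := h.coP a
    have h2 := key (P a)
    rw [ha, ← h.commP, real_inner_comm, ← h.inP, h.commP] at h2
    rw [h2] at h1
    have : ‖P a‖ ^ 2 ≤ 0 := by nlinarith [sq_nonneg ‖P a‖]
    have := pow_eq_zero_iff (two_ne_zero) |>.1 (le_antisymm this (sq_nonneg _))
    exact norm_eq_zero.1 this
  have hS : S a = 0 := by
    have h1 := h.coS a
    have h2 := key (S a)
    rw [ha, ← h.commS, real_inner_comm, ← h.inS, h.commS] at h2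
    rw [h2] at h1
    have : ‖S a‖ ^ 2 ≤ 0 := by nlinarith [sq_nonneg ‖S a‖]
    have := pow_eq_zero_iff (two_ne_zero) |>.1 (le_antisymm this (sq_nonneg _))
    exact norm_eq_zero.1 this
  ext x
  rw [ha, ← h.sum a, hP, hS]; simp

/-- Second order Taylor upper bound. -/
theorem taylor_two (Uf : Set H) (f : H → ℝ) (f' : H → (H →L[ℝ] ℝ))
    (hfderiv : ∀ ξ ∈ Uf, HasFDerivAt f (f' ξ) ξ)
    (f'' : H →L[ℝ] H →L[ℝ] ℝ) (R δ : ℝ) (hδ : 0 ≤ δ) (hR : Metric.ball 0 R ⊆ Uf)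
    (hT : ∀ ξ ∈ Metric.ball (0 : H) R, ‖f' ξ - f'' ξ‖ ≤ δ * ‖ξ‖)
    (ξ : H) (hξ : ξ ∈ Metric.ball (0 : H) R) :
    f ξ ≤ f 0 + f'' ξ ξ / 2 + δ * ‖ξ‖ ^ 2 := by
  have hmem : ∀ τ ∈ Icc (0 : ℝ) 1, τ • ξ ∈ Metric.ball (0 : H) R := by
    intro τ hτ
    rw [mem_ball_zero_iff] at hξ ⊢
    rw [norm_smul, Real.norm_eq_abs, abs_of_nonneg hτ.1]
    exact (mul_le_of_le_one_left (norm_nonneg _) hτ.2).trans_lt hξ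
  have hd : ∀ τ ∈ Icc (0 : ℝ) 1, HasDerivWithinAt (fun τ : ℝ => f (τ • ξ) - τ ^ 2 * (f'' ξ ξ / 2))
      (f' (τ • ξ) ((1 : ℝ) • ξ) - (2 * τ) * (f'' ξ ξ / 2)) (Icc 0 1) τ := by
    intro τ hτ
    have h1 := (hfderiv _ (hR (hmem τ hτ))).comp_hasDerivAt τ ((hasDerivAt_id τ).smul_const ξ)
    have h2 := ((hasDerivAt_pow 2 τ).mul_const (f'' ξ ξ / 2))
    have h3 := (h1.sub h2).hasDerivWithinAt (s := Icc 0 1)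
    exact h3.congr_deriv (by simp)
  have hb : ∀ τ ∈ Icc (0 : ℝ) 1, ‖f' (τ • ξ) ((1 : ℝ) • ξ) - (2 * τ) * (f'' ξ ξ / 2)‖ ≤
      δ * ‖ξ‖ ^ 2 := by
    intro τ hτ
    have e : f' (τ • ξ) ((1 : ℝ) • ξ) - (2 * τ) * (f'' ξ ξ / 2) =
        (f' (τ • ξ) - f'' (τ • ξ)) ξ := by
      simp; ring
    rw [e]
    refine (ContinuousLinearMap.le_opNorm _ _).trans ?_
    have h1 := hT _ (hmem τ hτ)
    rw [norm_smul, Real.norm_eq_abs, abs_of_nonneg hτ.1] at h1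
    have h2 : τ * ‖ξ‖ ≤ ‖ξ‖ := mul_le_of_le_one_left (norm_nonneg _) hτ.2
    calc _ ≤ (δ * ‖ξ‖) * ‖ξ‖ := by
          gcongr
          exact h1.trans (by gcongr)
      _ = _ := by ring
  have := Convex.norm_image_sub_le_of_norm_hasDerivWithin_le hd hb (convex_Icc 0 1)
    (left_mem_Icc.2 zero_le_one) (right_mem_Icc.2 zero_le_one)
  simp at this
  have := (abs_le.1 this).2
  linarith

theorem orthProjL_mem (V : Submodule ℝ H) (hV : IsClosed (V : Set H)) (x : H) :
    orthProjL V hV x ∈ V := by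
  unfold orthProjL
  simp

theorem sub_orthProjL_mem (V : Submodule ℝ H) (hV : IsClosed (V : Set H)) (x : H) :
    x - orthProjL V hV x ∈ Vᗮ := by
  haveI : CompleteSpace V := hV.completeSpace_coe
  exact V.sub_starProjection_mem_orthogonal x

theorem hypSplit_of (Hu Hs : Submodule ℝ H)
    (hu : IsClosed (Hu : Set H)) (hs : IsClosed (Hs : Set H)) (hsplit : Hs = Huᗮ)
    (L : H →L[ℝ] H) (lam : ℝ) (hlam : 0 < lam)
    (hLu : ∀ ξ ∈ Hu, L ξ ∈ Hu) (hLs : ∀ ξ ∈ Hs, L ξ ∈ Hs)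
    (hcoerc_u : ∀ ξ ∈ Hu, lam * ‖ξ‖ ^ 2 ≤ ⟪L ξ, ξ⟫)
    (hcoerc_s : ∀ ξ ∈ Hs, ⟪L ξ, ξ⟫ ≤ -lam * ‖ξ‖ ^ 2) :
    HypSplit L (orthProjL Hu hu) (orthProjL Hs hs) lam := by
  have hdis : ∀ x, x ∈ Hu → x ∈ Hs → x = 0 := by
    intro x h1 h2
    rw [hsplit] at h2
    exact inner_self_eq_zero.1 ((Submodule.mem_orthogonal Hu x).1 h2 x h1)
  have hss : Hsᗮ = Hu := by
    haveI : CompleteSpace Hu := hu.completeSpace_coe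
    rw [hsplit, Submodule.orthogonal_orthogonal]
  have mP := orthProjL_mem Hu hu
  have mS := orthProjL_mem Hs hs
  have cP : ∀ x, x - orthProjL Hu hu x ∈ Hs := fun x => by
    rw [hsplit]; exact sub_orthProjL_mem Hu hu x
  have cS : ∀ x, x - orthProjL Hs hs x ∈ Hu := fun x => by
    rw [← hss]; exact sub_orthProjL_mem Hs hs x
  have hsum : ∀ x, orthProjL Hu hu x + orthProjL Hs hs x = x := by
    intro x
    have := hdis (orthProjL Hu hu x - (x - orthProjL Hs hs x)) (Hu.sub_mem (mP x) (cS x)) (by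
      have := Hs.sub_mem (mS x) (cP x)
      convert this using 1
      abel)
    rw [← sub_eq_zero, ← this]; abel
  have idP : ∀ x ∈ Hu, orthProjL Hu hu x = x := fun x hx =>
    (sub_eq_zero.1 (hdis _ (Hu.sub_mem hx (mP x)) (cP x))).symm
  have idS : ∀ x ∈ Hs, orthProjL Hs hs x = x := fun x hx =>
    (sub_eq_zero.1 (hdis _ (cS x) (Hs.sub_mem hx (mS x)))).symm
  have zP : ∀ x ∈ Hs, orthProjL Hu hu x = 0 := fun x hx => by
    have := hsum x
    rw [idS x hx] at this
    simpa using this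
  have zS : ∀ x ∈ Hu, orthProjL Hs hs x = 0 := fun x hx => by
    have := hsum x
    rw [idP x hx] at this
    simpa using this
  refine ⟨hlam, hsum, ?_, ?_, ?_, fun x => hcoerc_u _ (mP x), fun x => hcoerc_s _ (mS x)⟩
  · intro x y
    have := mS y
    have h2 : orthProjL Hs hs y ∈ Huᗮ := by rw [← hsplit]; exact this
    exact (Submodule.mem_orthogonal Hu _).1 h2 _ (mP x)
  · intro x
    conv_lhs => rw [← hsum x]
    rw [map_add, map_add, idP _ (hLu _ (mP x)), zP _ (hLs _ (mS x)), add_zero]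
  · intro x
    conv_lhs => rw [← hsum x]
    rw [map_add, map_add, zS _ (hLu _ (mP x)), idS _ (hLs _ (mS x)), zero_add]

/-- Value of `f` at a point with unstable component of size `r` and small stable component. -/
theorem HypSplit.f_le {L P S : H →L[ℝ] H} {lam : ℝ} (h : HypSplit L P S lam)
    (f'' : H →L[ℝ] H →L[ℝ] ℝ) (c σ r : ℝ) (hc : 0 < c) (hσ : 0 < σ) (hσ2 : σ ≤ 1 / 2)
    (hσ3 : σ * (12 * (‖f''‖ + 1)) ≤ c)
    (hfs : ∀ x, f'' (P x) (P x) ≤ -c * ‖P x‖ ^ 2) (x : H) (hr : 0 ≤ r)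
    (hP : ‖P x‖ = r) (hS : ‖S x‖ ≤ σ * r) :
    f'' x x / 2 + c / 16 * ‖x‖ ^ 2 ≤ -(c / 4 * r ^ 2) := by
  have hC : 0 ≤ ‖f''‖ := ContinuousLinearMap.opNorm_nonneg f''
  set C := ‖f''‖
  have b : ∀ a b : H, f'' a b ≤ C * ‖a‖ * ‖b‖ := fun a b =>
    (le_abs_self _).trans (f''.le_opNorm₂ a b)
  have e : f'' x x = f'' (P x) (P x) + f'' (P x) (S x) + f'' (S x) (P x) + f'' (S x) (S x) := by
    conv_lhs => rw [← h.sum x]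
    simp only [map_add, ContinuousLinearMap.add_apply]
    ring
  have h1 := hfs x
  have h2 := b (P x) (S x)
  have h3 := b (S x) (P x)
  have h4 := b (S x) (S x)
  have h5 := h.norm_sq x
  rw [hP] at h1 h2 h3 h5
  have n := norm_nonneg (S x)
  have k2 : C * r * ‖S x‖ ≤ C * r * (σ * r) := by gcongr
  have k3 : C * ‖S x‖ * r ≤ C * (σ * r) * r := by gcongr
  have k4 : C * ‖S x‖ * ‖S x‖ ≤ C * (σ * r) * (1 * r) := by
    gcongr
    exact hS.trans (by gcongr; linarith)
  have k5 : ‖S x‖ ^ 2 ≤ r ^ 2 := by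
    have : ‖S x‖ ≤ r := hS.trans (by nlinarith)
    gcongr
  have k6 : C * σ * r ^ 2 ≤ c / 12 * r ^ 2 := by
    gcongr
    nlinarith
  rw [e, h5]
  nlinarith [mul_le_mul_of_nonneg_left k5 hc.le]

end Helpers


/-- Near a hyperbolic rest point `0` of a `C¹` vector field `F`, for
all small `r > 0`: orbits starting near `0` and reaching `∂Q(r)` while staying in
`Q(r)` exit closer and closer to `W^u_{loc,r} ∩ ∂Q(r)`; if moreover `f` is a
non-degenerate local Lyapunov function at `0`, the values of `f` at the exit points are
asymptotically strictly below `f(0)`, and the exit values of `f` of orbits starting in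
some smaller `Q(r')` are uniformly strictly smaller than the values of `f` on
`Q(r')`. -/
theorem exit_points_accumulate_on_local_unstable_manifold
    {H : Type*} [NormedAddCommGroup H] [InnerProductSpace ℝ H] [CompleteSpace H]
    (Hu Hs : Submodule ℝ H)
    (hu : IsClosed (Hu : Set H)) (hs : IsClosed (Hs : Set H)) (hsplit : Hs = Huᗮ)
    (U : Set H) (hU : IsOpen U) (h0U : (0 : H) ∈ U)
    (F : H → H) (hF : ContDiffOn ℝ 1 F U) (hF0 : F 0 = 0)
    (L : H →L[ℝ] H) (hL : HasFDerivAt F L 0)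
    (lam : ℝ) (hlam : 0 < lam)
    (hLu : ∀ ξ ∈ Hu, L ξ ∈ Hu) (hLs : ∀ ξ ∈ Hs, L ξ ∈ Hs)
    (hcoerc_u : ∀ ξ ∈ Hu, lam * ‖ξ‖ ^ 2 ≤ ⟪L ξ, ξ⟫)
    (hcoerc_s : ∀ ξ ∈ Hs, ⟪L ξ, ξ⟫ ≤ -lam * ‖ξ‖ ^ 2)
    -- a non-degenerate local Lyapunov function `f` for `F` at `0`
    (Uf : Set H) (hUf : IsOpen Uf) (h0Uf : (0 : H) ∈ Uf)
    (f : H → ℝ) (f' : H → (H →L[ℝ] ℝ))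
    (hfderiv : ∀ ξ ∈ Uf, HasFDerivAt f (f' ξ) ξ)
    (hf'cont : ContinuousOn f' Uf)
    (hlyap : ∀ ξ ∈ Uf, ξ ≠ 0 → f' ξ (F ξ) < 0)
    (f'' : H →L[ℝ] H →L[ℝ] ℝ) (hf'' : HasFDerivAt f' f'' 0)
    (c : ℝ) (hc : 0 < c)
    (hcoerc_f_s : ∀ ξ ∈ Hs, c * ‖ξ‖ ^ 2 ≤ f'' ξ ξ)
    (hcoerc_f_u : ∀ ξ ∈ Hu, f'' ξ ξ ≤ -c * ‖ξ‖ ^ 2) :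
    ∃ r₀ > (0 : ℝ), ∀ r : ℝ, 0 < r → r ≤ r₀ →
      (∀ ξ : ℕ → H, Tendsto ξ atTop (nhds 0) →
        ∀ t : ℕ → ℝ, (∀ n, 0 ≤ t n) →
        ∀ u : ℕ → ℝ → H,
        (∀ n, u n 0 = ξ n) →
        (∀ n, ∀ s ∈ Icc 0 (t n), u n s ∈ U) →
        (∀ n, ∀ s ∈ Icc 0 (t n), HasDerivWithinAt (u n) (F (u n s)) (Icc 0 (t n)) s) →
        (∀ n, ∀ s ∈ Icc 0 (t n), u n s ∈ squareNbhd Hu Hs hu hs r) →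
        (∀ n, u n (t n) ∈ squareNbhdBdry Hu Hs hu hs r) →
          Tendsto (fun n => Metric.infDist (u n (t n))
              (localUnstableSet Hu Hs hu hs U F r ∩ squareNbhdBdry Hu Hs hu hs r))
            atTop (nhds 0) ∧
          ∃ a : ℝ, a < f 0 ∧ ∀ᶠ n in atTop, f (u n (t n)) ≤ a) ∧
      (∃ r' : ℝ, 0 < r' ∧ r' < r ∧ ∃ b b' : ℝ, b < b' ∧
        (∀ ξ ∈ squareNbhdBdry Hu Hs hu hs r,
          (∃ T : ℝ, 0 < T ∧ ∃ v : ℝ → H, v 0 ∈ squareNbhd Hu Hs hu hs r' ∧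
            (∀ s ∈ Icc 0 T, v s ∈ U ∧ v s ∈ squareNbhd Hu Hs hu hs r) ∧
            (∀ s ∈ Icc 0 T, HasDerivWithinAt v (F (v s)) (Icc 0 T) s) ∧
            v T = ξ) → f ξ ≤ b) ∧
        (∀ ξ ∈ squareNbhd Hu Hs hu hs r', b' ≤ f ξ)) := by
  have h := hypSplit_of Hu Hs hu hs hsplit L lam hlam hLu hLs hcoerc_u hcoerc_s
  have mP := orthProjL_mem Hu hu
  have mS := orthProjL_mem Hs hs
  have hQ : ∀ ρ x, x ∈ squareNbhd Hu Hs hu hs ρ ↔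
    ‖orthProjL Hu hu x‖ ≤ ρ ∧ ‖orthProjL Hs hs x‖ ≤ ρ := fun _ _ => Iff.rfl
  have hB : ∀ ρ x, x ∈ squareNbhdBdry Hu Hs hu hs ρ ↔ x ∈ squareNbhd Hu Hs hu hs ρ ∧
    (‖orthProjL Hu hu x‖ = ρ ∨ ‖orthProjL Hs hs x‖ = ρ) := fun _ _ => Iff.rfl
  have hfs : ∀ x, f'' (orthProjL Hu hu x) (orthProjL Hu hu x) ≤ -c * ‖orthProjL Hu hu x‖ ^ 2 :=
    fun x => hcoerc_f_u _ (mP x)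
  generalize orthProjL Hu hu = P at *
  generalize orthProjL Hs hs = S at *
  have hC : 0 ≤ ‖f''‖ := ContinuousLinearMap.opNorm_nonneg f''
  obtain ⟨σ, hσ, hσ2, hσ3⟩ : ∃ σ : ℝ, 0 < σ ∧ σ ≤ 1 / 2 ∧ σ * (12 * (‖f''‖ + 1)) ≤ c := by
    refine ⟨min (1 / 2) (c / (12 * (‖f''‖ + 1))), by positivity, min_le_left _ _, ?_⟩
    rw [← le_div_iff₀ (by positivity)]
    exact min_le_right _ _
  obtain ⟨ε, hεdef⟩ : ∃ ε : ℝ, ε = σ * lam / 2 := ⟨_, rfl⟩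
  have hε : 0 < ε := by rw [hεdef]; positivity
  have hε4 : 4 * ε ≤ lam := by rw [hεdef]; nlinarith
  have hcrit := h.crit F hF0 hL Uf hUf h0Uf f' hlyap f'' hf''
  obtain ⟨R, hR, hRU, hRUf, hlip, htay⟩ : ∃ R > 0, Metric.ball (0 : H) R ⊆ U ∧
      Metric.ball (0 : H) R ⊆ Uf ∧
      (∀ x ∈ Metric.ball (0 : H) R, ∀ y ∈ Metric.ball (0 : H) R,
        ‖F x - F y - L (x - y)‖ ≤ ε * ‖x - y‖) ∧
      (∀ ξ ∈ Metric.ball (0 : H) R, ‖f' ξ - f'' ξ‖ ≤ c / 16 * ‖ξ‖) := by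
    have hstrict : HasStrictFDerivAt F L 0 :=
      (hF.contDiffAt (hU.mem_nhds h0U)).hasStrictFDerivAt' hL one_ne_zero
    obtain ⟨s, hs0, hs1⟩ := hstrict.approximates_deriv_on_nhds (c := (⟨ε, hε.le⟩ : NNReal))
      (Or.inr (show (⟨0, le_rfl⟩ : NNReal) < ⟨ε, hε.le⟩ from hε))
    have hlo := hf''.isLittleO.def (show 0 < c / 16 by positivity)
    have hnb := Filter.inter_mem (Filter.inter_mem (hU.mem_nhds h0U) (hUf.mem_nhds h0Uf))
      (Filter.inter_mem hs0 hlo)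
    obtain ⟨R, hR, hsub⟩ := Metric.mem_nhds_iff.1 hnb
    refine ⟨R, hR, fun x hx => (hsub hx).1.1, fun x hx => (hsub hx).1.2,
      fun x hx y hy => hs1 x (hsub hx).2.1 y (hsub hy).2.1, fun x hx => ?_⟩
    have := (hsub hx).2.2
    simpa [hcrit] using this
  refine ⟨R / 3, by positivity, fun r hr hr0 => ?_⟩
  have hQb : ∀ x ∈ squareNbhd Hu Hs hu hs r, ‖x‖ ≤ 2 * r ∧ x ∈ Metric.ball (0 : H) R := by
    intro x hx
    have h1 := (hQ r x).1 hx
    have h2 := h.norm_le_add x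
    have h3 : ‖x‖ ≤ 2 * r := by linarith [h1.1, h1.2]
    refine ⟨h3, ?_⟩
    rw [mem_ball_zero_iff]
    linarith
  have hN : ∀ x ∈ squareNbhd Hu Hs hu hs r, ‖F x - L x‖ ≤ ε * ‖x‖ := by
    intro x hx
    have := hlip x (hQb x hx).2 0 (Metric.mem_ball_self hR)
    simpa [hF0] using this
  -- behaviour at the exit
  have hexit : ∀ (T : ℝ) (v : ℝ → H), 0 ≤ T →
      (∀ s ∈ Icc 0 T, v s ∈ squareNbhd Hu Hs hu hs r) →
      (∀ s ∈ Icc 0 T, HasDerivWithinAt v (F (v s)) (Icc 0 T) s) →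
      ‖S (v 0)‖ ≤ σ * r → v T ∈ squareNbhdBdry Hu Hs hu hs r →
      ‖P (v T)‖ = r ∧ f (v T) ≤ f 0 - c / 4 * r ^ 2 := by
    intro T v hT hv hv' h0 hTb
    have h1 := h.stable_bound v (fun s => F (v s) - L (v s)) T r σ hT hr.le hσ.le
      (fun s hs => by simpa using hv' s hs) (fun s hs => by
        have h2 := hN _ (hv s hs)
        have h3 := (hQb _ (hv s hs)).1
        calc _ ≤ ε * ‖v s‖ := h2
          _ ≤ ε * (2 * r) := by gcongr
          _ = _ := by rw [hεdef]; ring) h0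
    have h2 := (hB r _).1 hTb
    have h3 : ‖P (v T)‖ = r := by
      rcases h2.2 with h4 | h4
      · exact h4
      · rw [h4] at h1; nlinarith
    refine ⟨h3, ?_⟩
    have h5 := h.f_le f'' c σ r hc hσ hσ2 hσ3 hfs (v T) hr.le h3 h1
    have h6 := taylor_two Uf f f' hfderiv f'' R (c / 16) (by positivity) hRUf htay (v T)
      (hQb _ h2.1).2
    linarith
  constructor
  · intro ξ hξ t ht u hu0 huU hu' huQ huB
    have hev : ∀ᶠ n in atTop, ‖S (u n 0)‖ ≤ σ * r := by
      have := hξ.norm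
      rw [norm_zero] at this
      filter_upwards [this.eventually (gt_mem_nhds (show 0 < σ * r by positivity))] with n hn
      rw [hu0]
      exact (h.normS_le _).trans hn.le
    refine ⟨?_, f 0 - c / 4 * r ^ 2, by nlinarith [mul_pos hc (pow_pos hr 2)], ?_⟩
    · -- exit times go to infinity
      have htop : Tendsto t atTop atTop := by
        rw [tendsto_atTop]
        intro M
        have hK : 0 ≤ ‖L‖ + ε := by positivity
        have h1 : Tendsto (fun n => Real.exp (2 * (‖L‖ + ε) * M) * ‖ξ n‖ ^ 2) atTop (nhds 0) := by
          have := ((hξ.norm).pow 2).const_mul (Real.exp (2 * (‖L‖ + ε) * M))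
          simpa using this
        filter_upwards [h1.eventually (gt_mem_nhds (show 0 < r ^ 2 by positivity))] with n hn
        by_contra hlt
        push Not at hlt
        have h2 := growth_bound (u n) (fun s => F (u n s)) (t n) (‖L‖ + ε) (ht n) (hu' n) (by
          intro s hs
          have h3 := hN _ (huQ n s hs)
          have h4 := L.le_opNorm (u n s)
          have h5 : F (u n s) = (F (u n s) - L (u n s)) + L (u n s) := by abel
          calc ‖F (u n s)‖ ≤ ‖F (u n s) - L (u n s)‖ + ‖L (u n s)‖ := by
                conv_lhs => rw [h5]
                exact norm_add_le _ _
            _ ≤ _ := by linarith)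
        rw [hu0] at h2
        have h6 : Real.exp (2 * (‖L‖ + ε) * t n) ≤ Real.exp (2 * (‖L‖ + ε) * M) := by
          apply Real.exp_le_exp.2
          gcongr
        have h7 : r ≤ ‖u n (t n)‖ := by
          rcases ((hB r _).1 (huB n)).2 with h8 | h8
          · rw [← h8]; exact h.normP_le _
          · rw [← h8]; exact h.normS_le _
        have h9 : r ^ 2 ≤ ‖u n (t n)‖ ^ 2 := by gcongr
        have h10 := mul_le_mul_of_nonneg_right h6 (sq_nonneg ‖ξ n‖)
        linarith
      have hlim : Tendsto (fun n => 2 * r * Real.exp (-(lam / 2 * t n))) atTop (nhds 0) := by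
        have h1 : Tendsto (fun n => lam / 2 * t n) atTop atTop :=
          htop.const_mul_atTop (by positivity)
        have := (Real.tendsto_exp_neg_atTop_nhds_zero.comp h1).const_mul (2 * r)
        simpa using this
      refine squeeze_zero' (Eventually.of_forall fun n => Metric.infDist_nonneg) ?_ hlim
      filter_upwards [hev] with n hn
      obtain ⟨hPr, -⟩ := hexit (t n) (u n) (ht n) (huQ n) (hu' n) hn (huB n)
      obtain ⟨v, hv0, hv⟩ := h.exists_backward (fun x => F x - L x) r ε hε.le hε4 (by simp [hF0])
        (fun x y h1 h2 h3 h4 => by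
          have := hlip x (hQb x ((hQ r x).2 ⟨h1, h2⟩)).2 y (hQb y ((hQ r y).2 ⟨h3, h4⟩)).2
          have e : F x - L x - (F y - L y) = F x - F y - L (x - y) := by
            rw [map_sub]; abel
          rw [e]; exact this)
        (P (u n (t n))) (h.PP _) hPr.le
      have hvQ : ∀ s ≤ 0, v s ∈ squareNbhd Hu Hs hu hs r := fun s hs =>
        (hQ r _).2 ⟨(hv s hs).1, (hv s hs).2.1⟩
      have hv' : ∀ s ≤ 0, HasDerivWithinAt v (F (v s)) (Iic 0) s := fun s hs => by
        have := (hv s hs).2.2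
        simpa using this
      have hmem : v 0 ∈ localUnstableSet Hu Hs hu hs U F r ∩ squareNbhdBdry Hu Hs hu hs r := by
        refine ⟨⟨hvQ 0 le_rfl, v, rfl, fun s hs => ⟨hRU (hQb _ (hvQ s hs)).2, hvQ s hs⟩, hv'⟩, ?_⟩
        rw [hB]
        exact ⟨hvQ 0 le_rfl, Or.inl (by rw [hv0]; exact hPr)⟩
      refine (Metric.infDist_le_dist_of_mem hmem).trans ?_
      have hsh : ∀ s ∈ Icc 0 (t n), s - t n ≤ 0 := fun s hs => by linarith [hs.2]
      have hvs : ∀ s ∈ Icc 0 (t n), HasDerivWithinAt (fun s => v (s - t n)) (F (v (s - t n)))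
          (Icc 0 (t n)) s := by
        intro s hs
        have h1 : HasDerivWithinAt (fun s : ℝ => s - t n) 1 (Icc 0 (t n)) s :=
          ((hasDerivAt_id s).sub_const (t n)).hasDerivWithinAt
        have := HasDerivWithinAt.scomp s (hv' _ (hsh s hs)) h1 (fun x hx => hsh x hx)
        exact this.congr_deriv (one_smul _ _)
      have hcone := h.cone (fun s => u n s - v (s - t n))
        (fun s => F (u n s) - F (v (s - t n)) - L (u n s - v (s - t n))) (t n) ε (ht n) hε4
        (fun s hs => by
          have := (hu' n s hs).sub (hvs s hs)
          refine this.congr_deriv ?_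
          abel)
        (fun s hs => hlip _ (hQb _ (huQ n s hs)).2 _ (hQb _ (hvQ _ (hsh s hs))).2)
      simp only [sub_self] at hcone
      have hPz : P (u n (t n) - v 0) = 0 := by rw [map_sub, hv0, sub_self]
      have e1 := h.norm_sq (u n (t n) - v 0)
      rw [hPz] at hcone e1
      have hSb : ‖S (u n 0 - v (0 - t n))‖ ≤ 2 * r := by
        rw [map_sub]
        have a1 := ((hQ r _).1 (huQ n 0 (left_mem_Icc.2 (ht n)))).2
        have a2 := ((hQ r _).1 (hvQ (0 - t n) (by linarith [ht n]))).2
        linarith [norm_sub_le (S (u n 0)) (S (v (0 - t n)))]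
      have hSb2 : ‖S (u n 0 - v (0 - t n))‖ ^ 2 ≤ (2 * r) ^ 2 := by gcongr
      have hee : (2 * r * Real.exp (-(lam / 2 * t n))) ^ 2 = Real.exp (-lam * t n) * (2 * r) ^ 2 := by
        rw [mul_pow, ← Real.exp_nat_mul]
        push_cast
        ring_nf
      rw [dist_eq_norm]
      refine abs_le_of_sq_le_sq' ?_ (by positivity) |>.2
      rw [hee]
      have h11 : Real.exp (-lam * t n) * (‖S (u n 0 - v (0 - t n))‖ ^ 2 -
          ‖P (u n 0 - v (0 - t n))‖ ^ 2) ≤ Real.exp (-lam * t n) * (2 * r) ^ 2 := by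
        apply mul_le_mul_of_nonneg_left _ (Real.exp_pos _).le
        linarith [sq_nonneg ‖P (u n 0 - v (0 - t n))‖]
      simp only [norm_zero] at hcone e1
      linarith
    · filter_upwards [hev] with n hn
      exact (hexit (t n) (u n) (ht n) (huQ n) (hu' n) hn (huB n)).2
  · have hcf : ContinuousAt f 0 := (hfderiv 0 h0Uf).continuousAt
    have hpos : 0 < c / 8 * r ^ 2 := by positivity
    obtain ⟨ρ, hρ, hρf⟩ := Metric.continuousAt_iff.1 hcf _ hpos
    refine ⟨min (σ * r) (ρ / 3), by positivity, (min_le_left _ _).trans_lt (by nlinarith),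
      f 0 - c / 4 * r ^ 2, f 0 - c / 8 * r ^ 2, by linarith, ?_, ?_⟩
    · rintro ξ hξ ⟨T, hT, v, hv0, hvQ, hv', rfl⟩
      exact (hexit T v hT.le (fun s hs => (hvQ s hs).2) hv'
        (((hQ _ _).1 hv0).2.trans (min_le_left _ _)) hξ).2
    · intro ξ hξ
      have h1 := (hQ _ _).1 hξ
      have h2 := h.norm_le_add ξ
      have h3 := min_le_right (σ * r) (ρ / 3)
      have h4 := hρf (x := ξ) (by rw [dist_zero_right]; linarith [h1.1, h1.2])
      rw [Real.dist_eq] at h4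
      linarith [(abs_lt.1 h4).1]
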